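/- arXiv:1705.04340 — 3 statements merged into one kernel-verified Lean document; each statement's English description precedes it below -/
import Mathlib

section
/- Let A be an invertible n×n real matrix, b ∈ ℝⁿ, and ε ≥ 0. Suppose X̂ is an n×n real matrix whose entries satisfy |X̂ᵢⱼ − (A⁻¹)ᵢⱼ| ≤ ε·|(A⁻¹)ᵢⱼ| for all i, j, and ŷ ∈ ℝⁿ satisfies ‖ŷ − X̂b‖_∞ ≤ ε·‖X̂‖·‖b‖_∞. Then ‖ŷ − A⁻¹b‖_∞ ≤ ε(2 + ε)·‖A⁻¹‖·‖b‖_∞. (This is the quantitative content of Theorem 2.1: multiplying an entrywise-accurate inverse by b yields an inverse-equivalent solution of Ax = b.) -/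
/- The matrix norm is the operator norm induced by the `‖·‖_∞` vector norm,
i.e. the maximum absolute row sum. -/
attribute [local instance] Matrix.linftyOpNormedAddCommGroup

/-- The `ℓ∞` operator norm is monotone in the absolute values of the entries, up to scaling. -/
theorem linfty_opNorm_le_mul_of_abs_le {m n : Type*} [Fintype m] [Fintype n]
    {M N : Matrix m n ℝ} {c : ℝ} (hc : 0 ≤ c) (h : ∀ i j, |M i j| ≤ c * |N i j|) :
    ‖M‖ ≤ c * ‖N‖ := by
  lift c to NNReal using hc
  rw [Matrix.linfty_opNorm_def, Matrix.linfty_opNorm_def, ← NNReal.coe_mul, NNReal.coe_le_coe]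
  refine Finset.sup_le fun i hi => ?_
  calc ∑ j, ‖M i j‖₊ ≤ ∑ j, c * ‖N i j‖₊ := Finset.sum_le_sum fun j _ => h i j
    _ = c * ∑ j, ‖N i j‖₊ := (Finset.mul_sum _ _ _).symm
    _ ≤ _ := mul_le_mul_right (Finset.le_sup (f := fun i => ∑ j, ‖N i j‖₊) hi) c

theorem stmt0 {n : ℕ} (A Xhat : Matrix (Fin n) (Fin n) ℝ) (hA : IsUnit A)
    (b yhat : Fin n → ℝ) (ε : ℝ) (hε : 0 ≤ ε)
    (hX : ∀ i j, |Xhat i j - A⁻¹ i j| ≤ ε * |A⁻¹ i j|)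
    (hy : ‖yhat - Xhat.mulVec b‖ ≤ ε * ‖Xhat‖ * ‖b‖) :
    ‖yhat - A⁻¹.mulVec b‖ ≤ ε * (2 + ε) * ‖A⁻¹‖ * ‖b‖ := by
  have hdiff : ‖Xhat - A⁻¹‖ ≤ ε * ‖A⁻¹‖ := linfty_opNorm_le_mul_of_abs_le hε hX
  have hXhat : ‖Xhat‖ ≤ (1 + ε) * ‖A⁻¹‖ := by
    have := norm_le_norm_add_norm_sub A⁻¹ Xhat
    rw [norm_sub_rev] at this
    linarith
  calc ‖yhat - A⁻¹.mulVec b‖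
      = ‖(yhat - Xhat.mulVec b) + (Xhat - A⁻¹).mulVec b‖ := by
        rw [Matrix.sub_mulVec, sub_add_sub_cancel]
    _ ≤ ‖yhat - Xhat.mulVec b‖ + ‖(Xhat - A⁻¹).mulVec b‖ := norm_add_le _ _
    _ ≤ ε * ((1 + ε) * ‖A⁻¹‖) * ‖b‖ + ε * ‖A⁻¹‖ * ‖b‖ := by
        refine add_le_add (hy.trans (by gcongr)) ?_
        exact (Matrix.linfty_opNorm_mulVec _ _).trans (by gcongr)
    _ = ε * (2 + ε) * ‖A⁻¹‖ * ‖b‖ := by ring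
end

section
/- Let A be an invertible n×n real matrix, b ∈ ℝⁿ, and ε ≥ 0. Suppose X̂ is an n×n real matrix with ‖X̂ − A⁻¹‖ ≤ ε·‖A⁻¹‖, and x̂ ∈ ℝⁿ satisfies ‖x̂ − X̂b‖ ≤ ε·‖X̂‖·‖b‖. Then ‖x̂ − A⁻¹b‖ ≤ ε(2 + ε)·‖A⁻¹‖·‖b‖. (Backward direction of Theorem 2.2: a relatively accurate computed inverse yields an inverse-equivalent algorithm for solving Ax = b.) -/
/-- Euclidean norm of a vector in `ℝⁿ`. -/
noncomputable def vnorm {n : ℕ} (v : Fin n → ℝ) : ℝ :=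
  ‖(WithLp.equiv 2 (Fin n → ℝ)).symm v‖

/-- Operator norm (spectral norm) of a matrix, induced by the Euclidean norm. -/
noncomputable def opnorm {n : ℕ} (A : Matrix (Fin n) (Fin n) ℝ) : ℝ :=
  ‖Matrix.toEuclideanCLM (𝕜 := ℝ) A‖

theorem vnorm_nonneg {n : ℕ} (v : Fin n → ℝ) : 0 ≤ vnorm v := norm_nonneg _

theorem vnorm_add_le {n : ℕ} (v w : Fin n → ℝ) : vnorm (v + w) ≤ vnorm v + vnorm w :=
  norm_add_le (WithLp.toLp 2 v) (WithLp.toLp 2 w)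

theorem opnorm_add_le {n : ℕ} (A B : Matrix (Fin n) (Fin n) ℝ) :
    opnorm (A + B) ≤ opnorm A + opnorm B := by
  unfold opnorm
  rw [map_add]
  exact norm_add_le _ _

theorem vnorm_mulVec_le {n : ℕ} (A : Matrix (Fin n) (Fin n) ℝ) (v : Fin n → ℝ) :
    vnorm (A.mulVec v) ≤ opnorm A * vnorm v :=
  (Matrix.toEuclideanCLM (𝕜 := ℝ) A).le_opNorm (WithLp.toLp 2 v)

theorem stmt2 {n : ℕ} (A Xhat : Matrix (Fin n) (Fin n) ℝ) (hA : IsUnit A)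
    (b xhat : Fin n → ℝ) (ε : ℝ) (hε : 0 ≤ ε)
    (hX : opnorm (Xhat - A⁻¹) ≤ ε * opnorm A⁻¹)
    (hx : vnorm (xhat - Xhat.mulVec b) ≤ ε * opnorm Xhat * vnorm b) :
    vnorm (xhat - A⁻¹.mulVec b) ≤ ε * (2 + ε) * opnorm A⁻¹ * vnorm b := by
  have hXhat : opnorm Xhat ≤ (1 + ε) * opnorm A⁻¹ := by
    have h := opnorm_add_le (Xhat - A⁻¹) A⁻¹
    rw [sub_add_cancel] at h
    linarith
  have hsplit : xhat - A⁻¹.mulVec b = (xhat - Xhat.mulVec b) + (Xhat - A⁻¹).mulVec b := by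
    rw [Matrix.sub_mulVec, sub_add_sub_cancel]
  have hb := vnorm_nonneg b
  calc vnorm (xhat - A⁻¹.mulVec b)
      ≤ vnorm (xhat - Xhat.mulVec b) + vnorm ((Xhat - A⁻¹).mulVec b) :=
        hsplit ▸ vnorm_add_le _ _
    _ ≤ ε * opnorm Xhat * vnorm b + opnorm (Xhat - A⁻¹) * vnorm b :=
        add_le_add hx (vnorm_mulVec_le _ _)
    _ ≤ ε * ((1 + ε) * opnorm A⁻¹) * vnorm b + ε * opnorm A⁻¹ * vnorm b := by gcongr
    _ = ε * (2 + ε) * opnorm A⁻¹ * vnorm b := by ring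
end

section
/- Let A be an invertible n×n real matrix, b ∈ ℝⁿ, and x := A⁻¹b. Let u ∈ ℝⁿ be a unit vector (‖u‖ = 1) and σ > 0 satisfy ‖Aᵀu‖ ≤ σ and uᵀb ≠ 0. Then ‖x‖ ≥ |uᵀb|/σ, and consequently (‖A⁻¹‖·‖b‖)/‖x‖ ≤ σ·‖A⁻¹‖·(‖b‖/|uᵀb|). (Inequality (2.6): if b has a significant projection on a left singular vector corresponding to a singular value σ much smaller than the largest, the inverse-equivalent error bound ‖A⁻¹‖‖b‖ is much smaller than κ(A)‖x‖.) -/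
open Matrix

/-- Condition number `κ(A) = ‖A‖·‖A⁻¹‖` with respect to the spectral norm. -/
noncomputable def condNum {n : ℕ} (A : Matrix (Fin n) (Fin n) ℝ) : ℝ :=
  opnorm A * opnorm A⁻¹


/-- Cauchy–Schwarz for the dot product and `vnorm`. -/
theorem abs_dotProduct_le_vnorm_mul_vnorm {n : ℕ} (v w : Fin n → ℝ) :
    |v ⬝ᵥ w| ≤ vnorm v * vnorm w := by
  have h := abs_real_inner_le_norm (WithLp.toLp 2 v) (WithLp.toLp 2 w)
  rwa [EuclideanSpace.inner_toLp_toLp, star_trivial, dotProduct_comm] at h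

theorem stmt4 {n : ℕ} (A : Matrix (Fin n) (Fin n) ℝ) (hA : IsUnit A)
    (b : Fin n → ℝ) (x : Fin n → ℝ) (hx : x = A⁻¹.mulVec b)
    (u : Fin n → ℝ) (hu : vnorm u = 1) (σ : ℝ) (hσ : 0 < σ)
    (hAu : vnorm (Aᵀ.mulVec u) ≤ σ) (hub : u ⬝ᵥ b ≠ 0) :
    |u ⬝ᵥ b| / σ ≤ vnorm x ∧
      opnorm A⁻¹ * vnorm b / vnorm x ≤ σ * opnorm A⁻¹ * (vnorm b / |u ⬝ᵥ b|) := by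
  have hb : A *ᵥ x = b := by
    rw [hx, mulVec_mulVec, mul_nonsing_inv A ((isUnit_iff_isUnit_det A).mp hA), one_mulVec]
  have hub_eq : u ⬝ᵥ b = (Aᵀ *ᵥ u) ⬝ᵥ x := by
    rw [← hb, dotProduct_mulVec, mulVec_transpose]
  have hx_nonneg : 0 ≤ vnorm x := norm_nonneg _
  have hle : |u ⬝ᵥ b| ≤ σ * vnorm x := by
    rw [hub_eq]
    exact (abs_dotProduct_le_vnorm_mul_vnorm _ _).trans
      (mul_le_mul_of_nonneg_right hAu hx_nonneg)
  have hpos : 0 < |u ⬝ᵥ b| := abs_pos.mpr hub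
  have hlower : |u ⬝ᵥ b| / σ ≤ vnorm x := (div_le_iff₀' hσ).mpr hle
  refine ⟨hlower, ?_⟩
  have hnum : 0 ≤ opnorm A⁻¹ * vnorm b := mul_nonneg (norm_nonneg _) (norm_nonneg _)
  calc opnorm A⁻¹ * vnorm b / vnorm x
      ≤ opnorm A⁻¹ * vnorm b / (|u ⬝ᵥ b| / σ) :=
        div_le_div_of_nonneg_left hnum (div_pos hpos hσ) hlower
    _ = σ * opnorm A⁻¹ * (vnorm b / |u ⬝ᵥ b|) := by
        field_simp
end
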